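/- (Schur–Weyl twirl over the orthogonal group.) Let d ≥ 2 and let A be any matrix indexed by Fin d × Fin d over ℂ. Then ∫ (O ⊗ₖ O) * A * (O ⊗ₖ O)ᵀ dμ_O(O) = c₁ • 1 + c₂ • S + c₃ • S^{T_B}, where c₁ = ((d+1)·trace(A) − trace(S*A) − trace(S^{T_B}*A))/(d(d−1)(d+2)), c₂ = (−trace(A) + (d+1)·trace(S*A) − trace(S^{T_B}*A))/(d(d−1)(d+2)), and c₃ = (−trace(A) − trace(S*A) + (d+1)·trace(S^{T_B}*A))/(d(d−1)(d+2)). -/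

import Mathlib

open Matrix MeasureTheory
open scoped Kronecker

attribute [local instance] Matrix.normedAddCommGroup Matrix.normedSpace

/-- The swap operator `S` on `ℂ^(d·d)`: `S_{(i,j),(k,l)} = 1` iff `i = l` and `j = k`. -/
def swapOp (d : ℕ) : Matrix (Fin d × Fin d) (Fin d × Fin d) ℂ :=
  Matrix.of fun p q => if p.1 = q.2 ∧ p.2 = q.1 then 1 else 0

/-- Partial transpose on the second subsystem: `(X^{T_B})_{(i,j),(k,l)} = X_{(i,l),(k,j)}`. -/
def ptB {d : ℕ} (X : Matrix (Fin d × Fin d) (Fin d × Fin d) ℂ) :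
    Matrix (Fin d × Fin d) (Fin d × Fin d) ℂ :=
  Matrix.of fun p q => X (p.1, q.2) (q.1, p.2)

noncomputable instance (d : ℕ) : MeasurableSpace (Matrix.orthogonalGroup (Fin d) ℝ) := borel _
instance (d : ℕ) : BorelSpace (Matrix.orthogonalGroup (Fin d) ℝ) := ⟨rfl⟩

/-- The entrywise complexification of a real orthogonal matrix. -/
noncomputable def orthC {d : ℕ} (O : Matrix.orthogonalGroup (Fin d) ℝ) :
    Matrix (Fin d) (Fin d) ℂ :=
  (O : Matrix (Fin d) (Fin d) ℝ).map Complex.ofReal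

/-- Conjugation of `A` by `O ⊗ O`. -/
noncomputable def conjKron {d : ℕ} (A : Matrix (Fin d × Fin d) (Fin d × Fin d) ℂ)
    (O : Matrix.orthogonalGroup (Fin d) ℝ) : Matrix (Fin d × Fin d) (Fin d × Fin d) ℂ :=
  (orthC O ⊗ₖ orthC O) * A * (orthC O ⊗ₖ orthC O)ᵀ

section Twirl

variable {d : ℕ}

lemma orthC_mul (P O : Matrix.orthogonalGroup (Fin d) ℝ) :
    orthC (P * O) = orthC P * orthC O :=
  Matrix.map_mul (f := Complex.ofRealHom)

lemma orthC_transpose_mul_self (O : Matrix.orthogonalGroup (Fin d) ℝ) :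
    (orthC O)ᵀ * orthC O = 1 := by
  have h : (O : Matrix (Fin d) (Fin d) ℝ)ᵀ * (O : Matrix (Fin d) (Fin d) ℝ) = 1 := by
    have := (Matrix.mem_orthogonalGroup_iff' (Fin d) ℝ).1 O.2
    simpa [Matrix.star_eq_conjTranspose] using this
  have h2 := congrArg (fun X : Matrix (Fin d) (Fin d) ℝ => X.map Complex.ofRealHom) h
  simp only [Matrix.map_mul] at h2
  rw [Matrix.map_one _ (map_zero _) (map_one _)] at h2
  exact h2

lemma conjKron_mul (A : Matrix (Fin d × Fin d) (Fin d × Fin d) ℂ)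
    (P O : Matrix.orthogonalGroup (Fin d) ℝ) :
    conjKron A (P * O) = conjKron (conjKron A O) P := by
  simp only [conjKron, orthC_mul, Matrix.mul_kronecker_mul, Matrix.transpose_mul, Matrix.mul_assoc]

lemma continuous_conjKron (A : Matrix (Fin d × Fin d) (Fin d × Fin d) ℂ) :
    Continuous (conjKron A) := by
  have h : Continuous (orthC (d := d)) :=
    Continuous.matrix_map continuous_subtype_val Complex.continuous_ofReal
  have h2 : Continuous fun O : Matrix.orthogonalGroup (Fin d) ℝ => orthC O ⊗ₖ orthC O := by
    refine continuous_matrix fun i j => ?_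
    exact (h.matrix_elem _ _).mul (h.matrix_elem _ _)
  exact (h2.matrix_mul continuous_const).matrix_mul h2.matrix_transpose

lemma norm_orthC_apply_le (O : Matrix.orthogonalGroup (Fin d) ℝ) (i j : Fin d) :
    ‖orthC O i j‖ ≤ 1 := by
  simpa [orthC] using entry_norm_bound_of_unitary O.2 i j

lemma norm_conjKron_le (A : Matrix (Fin d × Fin d) (Fin d × Fin d) ℂ)
    (O : Matrix.orthogonalGroup (Fin d) ℝ) : ‖conjKron A O‖ ≤ ∑ p, ∑ q, ‖A p q‖ := by
  refine (Matrix.norm_le_iff (by positivity)).2 fun p q => ?_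
  have hU (p q : Fin d × Fin d) : ‖(orthC O ⊗ₖ orthC O) p q‖ ≤ 1 := by
    rw [Matrix.kronecker_apply, norm_mul]
    exact mul_le_one₀ (norm_orthC_apply_le _ _ _) (norm_nonneg _) (norm_orthC_apply_le _ _ _)
  simp only [conjKron, Matrix.mul_apply, Matrix.transpose_apply, Finset.sum_mul]
  rw [Finset.sum_comm]
  refine (norm_sum_le _ _).trans (Finset.sum_le_sum fun a _ => (norm_sum_le _ _).trans
    (Finset.sum_le_sum fun b _ => ?_))
  rw [norm_mul, norm_mul]
  calc _ ≤ 1 * ‖A a b‖ * 1 := by gcongr <;> apply hU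
    _ = _ := by ring

/-- Linear maps commute with integrals of bounded continuous functions. -/
lemma integral_linearMap_comp {G E F : Type*} [TopologicalSpace G] [MeasurableSpace G]
    [OpensMeasurableSpace G] [NormedAddCommGroup E] [NormedSpace ℝ E] [FiniteDimensional ℝ E]
    [NormedAddCommGroup F] [NormedSpace ℝ F] [FiniteDimensional ℝ F]
    (μ : Measure G) [IsProbabilityMeasure μ] (L : E →ₗ[ℝ] F) {f : G → E} (hf : Continuous f)
    {C : ℝ} (hC : ∀ x, ‖f x‖ ≤ C) : ∫ x, L (f x) ∂μ = L (∫ x, f x ∂μ) := by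
  have := FiniteDimensional.proper ℝ E
  have := FiniteDimensional.complete ℝ E
  have := FiniteDimensional.complete ℝ F
  exact (LinearMap.toContinuousLinearMap L).integral_comp_comm
    (Integrable.of_bound hf.aestronglyMeasurable C (Filter.Eventually.of_forall hC))

/-- The twirl of `A` is invariant under conjugation by `O ⊗ O`. -/
lemma conjKron_integral (A : Matrix (Fin d × Fin d) (Fin d × Fin d) ℂ)
    (μ : Measure (Matrix.orthogonalGroup (Fin d) ℝ)) [μ.IsHaarMeasure] [IsProbabilityMeasure μ]
    (Q : Matrix.orthogonalGroup (Fin d) ℝ) :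
    conjKron (∫ O, conjKron A O ∂μ) Q = ∫ O, conjKron A O ∂μ := by
  let L : Matrix (Fin d × Fin d) (Fin d × Fin d) ℂ →ₗ[ℝ]
      Matrix (Fin d × Fin d) (Fin d × Fin d) ℂ :=
    (LinearMap.mulRight ℝ (orthC Q ⊗ₖ orthC Q)ᵀ).comp (LinearMap.mulLeft ℝ (orthC Q ⊗ₖ orthC Q))
  calc _ = ∫ O, conjKron (conjKron A O) Q ∂μ :=
        (integral_linearMap_comp μ L (continuous_conjKron A) (norm_conjKron_le A)).symm
    _ = ∫ O, conjKron A (Q * O) ∂μ := by simp only [conjKron_mul]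
    _ = _ := integral_mul_left_eq_self _ Q

/-- Twirling preserves traces against operators commuting with all `O ⊗ O`. -/
lemma trace_mul_integral_conjKron (A B : Matrix (Fin d × Fin d) (Fin d × Fin d) ℂ)
    (μ : Measure (Matrix.orthogonalGroup (Fin d) ℝ)) [IsProbabilityMeasure μ]
    (hB : ∀ O, (orthC O ⊗ₖ orthC O)ᵀ * B * (orthC O ⊗ₖ orthC O) = B) :
    Matrix.trace (B * ∫ O, conjKron A O ∂μ) = Matrix.trace (B * A) := by
  let L : Matrix (Fin d × Fin d) (Fin d × Fin d) ℂ →ₗ[ℝ] ℂ :=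
    (Matrix.traceLinearMap _ ℝ ℂ).comp (LinearMap.mulLeft ℝ B)
  have h (O) : Matrix.trace (B * conjKron A O) = Matrix.trace (B * A) := by
    conv_rhs => rw [← hB O]
    rw [conjKron, ← Matrix.mul_assoc, Matrix.trace_mul_comm]
    simp only [Matrix.mul_assoc]
  calc _ = ∫ O, Matrix.trace (B * conjKron A O) ∂μ :=
        (integral_linearMap_comp μ L (continuous_conjKron A) (norm_conjKron_le A)).symm
    _ = _ := by simp [h]

lemma kronecker_transpose_mul_self (O : Matrix.orthogonalGroup (Fin d) ℝ) :
    (orthC O ⊗ₖ orthC O)ᵀ * (orthC O ⊗ₖ orthC O) = 1 := by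
  rw [← Matrix.kroneckerMap_transpose, ← Matrix.mul_kronecker_mul, orthC_transpose_mul_self,
    Matrix.one_kronecker_one]

lemma swapOp_apply (p q : Fin d × Fin d) :
    swapOp d p q = if p.1 = q.2 ∧ p.2 = q.1 then 1 else 0 := rfl

lemma swapOp_mul_apply (X : Matrix (Fin d × Fin d) (Fin d × Fin d) ℂ) (p q : Fin d × Fin d) :
    (swapOp d * X) p q = X p.swap q := by
  rw [Matrix.mul_apply, Finset.sum_eq_single p.swap]
  · simp [swapOp]
  · intro b _ hb
    have : ¬ (p.1 = b.2 ∧ p.2 = b.1) := fun h => hb (Prod.ext h.2.symm h.1.symm)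
    simp [swapOp, this]
  · simp

lemma mul_swapOp_apply (X : Matrix (Fin d × Fin d) (Fin d × Fin d) ℂ) (p q : Fin d × Fin d) :
    (X * swapOp d) p q = X p q.swap := by
  rw [Matrix.mul_apply, Finset.sum_eq_single q.swap]
  · simp [swapOp]
  · intro b _ hb
    have : ¬ (b.1 = q.2 ∧ b.2 = q.1) := fun h => hb (Prod.ext h.1 h.2)
    simp [swapOp, this]
  · simp

lemma swapOp_conj_kronecker (O : Matrix.orthogonalGroup (Fin d) ℝ) :
    (orthC O ⊗ₖ orthC O)ᵀ * swapOp d * (orthC O ⊗ₖ orthC O) = swapOp d := by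
  have h : swapOp d * (orthC O ⊗ₖ orthC O) = (orthC O ⊗ₖ orthC O) * swapOp d := by
    ext p q
    rw [swapOp_mul_apply, mul_swapOp_apply]
    simp [mul_comm]
  rw [Matrix.mul_assoc, h, ← Matrix.mul_assoc, kronecker_transpose_mul_self, Matrix.one_mul]

lemma ptB_swapOp_apply (p q : Fin d × Fin d) :
    ptB (swapOp d) p q = if p.1 = p.2 ∧ q.1 = q.2 then 1 else 0 := by
  simp only [ptB, swapOp, Matrix.of_apply, @eq_comm _ q.2 q.1]

lemma ptB_swapOp_eq_vecMulVec :
    ptB (swapOp d) = Matrix.vecMulVec (fun p => if p.1 = p.2 then 1 else 0)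
      (fun p => if p.1 = p.2 then 1 else 0) := by
  ext p q
  rw [ptB_swapOp_apply, Matrix.vecMulVec_apply, ite_and]
  split_ifs <;> simp

lemma vecMul_kronecker_diag (O : Matrix.orthogonalGroup (Fin d) ℝ) :
    (fun p : Fin d × Fin d => if p.1 = p.2 then (1 : ℂ) else 0) ᵥ* (orthC O ⊗ₖ orthC O) =
      fun p => if p.1 = p.2 then 1 else 0 := by
  ext ⟨k, l⟩
  have h := congrFun (congrFun (orthC_transpose_mul_self O) k) l
  rw [Matrix.mul_apply, Matrix.one_apply] at h
  simpa [Matrix.vecMul, dotProduct, Fintype.sum_prod_type, Matrix.kronecker_apply] using h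

lemma ptB_swapOp_conj_kronecker (O : Matrix.orthogonalGroup (Fin d) ℝ) :
    (orthC O ⊗ₖ orthC O)ᵀ * ptB (swapOp d) * (orthC O ⊗ₖ orthC O) = ptB (swapOp d) := by
  rw [ptB_swapOp_eq_vecMulVec, Matrix.mul_vecMulVec, Matrix.vecMulVec_mul,
    Matrix.mulVec_transpose, vecMul_kronecker_diag]

lemma conjKron_apply (X : Matrix (Fin d × Fin d) (Fin d × Fin d) ℂ)
    (Q : Matrix.orthogonalGroup (Fin d) ℝ) (i j k l : Fin d) :
    conjKron X Q (i, j) (k, l) =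
      ∑ a, orthC Q i a * ∑ b, orthC Q j b * ∑ c, orthC Q k c * ∑ e, orthC Q l e *
        X (a, b) (c, e) := by
  have : conjKron X Q (i, j) (k, l) = ∑ p, (orthC Q ⊗ₖ orthC Q) (i, j) p *
      ∑ q, (orthC Q ⊗ₖ orthC Q) (k, l) q * X p q := by
    rw [conjKron, Matrix.mul_assoc, Matrix.mul_apply]
    simp only [Matrix.mul_apply, Matrix.transpose_apply, mul_comm (X _ _)]
  rw [this]
  simp only [Matrix.kronecker_apply, Fintype.sum_prod_type, Finset.mul_sum, mul_assoc]

/-- Householder reflections are orthogonal. -/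
lemma householder_mem_orthogonalGroup (w : Fin d → ℝ) (hw : w ⬝ᵥ w ≠ 0) :
    1 - (2 / (w ⬝ᵥ w)) • Matrix.vecMulVec w w ∈ Matrix.orthogonalGroup (Fin d) ℝ := by
  rw [Matrix.mem_orthogonalGroup_iff]
  have hs : (1 - (2 / (w ⬝ᵥ w)) • Matrix.vecMulVec w w)ᵀ =
      1 - (2 / (w ⬝ᵥ w)) • Matrix.vecMulVec w w := by
    ext i j
    simp [Matrix.vecMulVec_apply, Matrix.one_apply, eq_comm, mul_comm]
  rw [hs]
  have hv : Matrix.vecMulVec w w * Matrix.vecMulVec w w = (w ⬝ᵥ w) • Matrix.vecMulVec w w := by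
    rw [Matrix.vecMulVec_mul_vecMulVec, Matrix.vecMulVec_smul]
  simp only [mul_sub, sub_mul, one_mul, mul_one, Matrix.smul_mul, Matrix.mul_smul, hv, smul_smul]
  rw [div_mul_cancel₀ _ hw]
  module

lemma exists_orthC_sign (p : Fin d) : ∃ Q : Matrix.orthogonalGroup (Fin d) ℝ, ∀ i a,
    orthC Q i a = if a = i then (if i = p then -1 else 1) else 0 := by
  have hw : (Pi.single p 1 : Fin d → ℝ) ⬝ᵥ Pi.single p 1 = 1 := by simp
  refine ⟨⟨_, householder_mem_orthogonalGroup (Pi.single p 1) (by simp)⟩, fun i a => ?_⟩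
  simp only [orthC, Matrix.map_apply, hw, Matrix.sub_apply, Matrix.smul_apply,
    Matrix.vecMulVec_apply, Matrix.one_apply, Pi.single_apply]
  by_cases h1 : a = i
  · subst h1
    by_cases h2 : a = p <;> simp [h2]
    norm_num
  · by_cases h2 : i = p
    · subst h2
      simp [h1, Ne.symm h1]
    · simp [h1, Ne.symm h1, h2]

lemma exists_orthC_perm (σ : Equiv.Perm (Fin d)) : ∃ Q : Matrix.orthogonalGroup (Fin d) ℝ,
    ∀ i a, orthC Q i a = if a = σ i then 1 else 0 := by
  have h : σ.permMatrix ℝ ∈ Matrix.orthogonalGroup (Fin d) ℝ := by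
    rw [Matrix.mem_orthogonalGroup_iff, Matrix.transpose_permMatrix, ← Matrix.permMatrix_mul, inv_mul_cancel,
      Matrix.permMatrix_one]
  refine ⟨⟨_, h⟩, fun i a => ?_⟩
  simp only [orthC, Matrix.map_apply, Equiv.Perm.permMatrix, PEquiv.toMatrix_apply]
  by_cases h1 : a = σ i
  · subst h1
    simp
  · simp [h1, Ne.symm h1]

lemma exists_orthC_row {p q : Fin d} (hpq : p ≠ q) :
    ∃ Q : Matrix.orthogonalGroup (Fin d) ℝ, ∀ a,
      orthC Q p a = (if a = p then 3 / 5 else 0) + (if a = q then -4 / 5 else 0) := by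
  have hw : (Pi.single p 1 + Pi.single q 2 : Fin d → ℝ) ⬝ᵥ (Pi.single p 1 + Pi.single q 2) = 5 := by
    simp [hpq, hpq.symm]
    norm_num
  refine ⟨⟨_, householder_mem_orthogonalGroup (Pi.single p 1 + Pi.single q 2)
    (by rw [hw]; norm_num)⟩, fun a => ?_⟩
  simp only [orthC, Matrix.map_apply, hw, Matrix.sub_apply, Matrix.smul_apply, Pi.add_apply,
    Matrix.vecMulVec_apply, Matrix.one_apply, Pi.single_apply]
  by_cases h1 : a = p
  · subst h1
    simp [hpq]
    norm_num
  · by_cases h2 : a = q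
    · subst h2
      simp [hpq, h1]
      norm_num
    · simp [h1, h2, Ne.symm h1]

lemma exists_perm_map_pair {p q r s : Fin d} (hpq : p ≠ q) (hrs : r ≠ s) :
    ∃ σ : Equiv.Perm (Fin d), σ p = r ∧ σ q = s := by
  have h : Equiv.swap p r q ≠ r := fun h =>
    hpq ((Equiv.swap p r).injective (by rw [h, Equiv.swap_apply_left]))
  exact ⟨Equiv.swap (Equiv.swap p r q) s * Equiv.swap p r,
    by simp [Equiv.swap_apply_of_ne_of_ne h.symm hrs], by simp⟩

lemma apply_eq_sign_mul_apply {X : Matrix (Fin d × Fin d) (Fin d × Fin d) ℂ}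
    (hX : ∀ Q, conjKron X Q = X) (p i j k l : Fin d) :
    X (i, j) (k, l) = (if i = p then -1 else 1) * ((if j = p then -1 else 1) *
      ((if k = p then -1 else 1) * ((if l = p then -1 else 1) * X (i, j) (k, l)))) := by
  obtain ⟨Q, hQ⟩ := exists_orthC_sign p
  have h := conjKron_apply X Q i j k l
  rw [hX] at h
  simpa only [hQ, ite_mul, zero_mul, Finset.sum_ite_eq', Finset.mem_univ, if_true] using h

lemma apply_perm {X : Matrix (Fin d × Fin d) (Fin d × Fin d) ℂ}
    (hX : ∀ Q, conjKron X Q = X) (σ : Equiv.Perm (Fin d)) (i j k l : Fin d) :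
    X (i, j) (k, l) = X (σ i, σ j) (σ k, σ l) := by
  obtain ⟨Q, hQ⟩ := exists_orthC_perm σ
  have h := conjKron_apply X Q i j k l
  rw [hX] at h
  simpa only [hQ, ite_mul, zero_mul, one_mul, Finset.sum_ite_eq', Finset.mem_univ, if_true] using h

lemma apply_eq_zero {X : Matrix (Fin d × Fin d) (Fin d × Fin d) ℂ}
    (hX : ∀ Q, conjKron X Q = X) {i j k l : Fin d} (h₁ : ¬ (i = k ∧ j = l))
    (h₂ : ¬ (i = l ∧ j = k)) (h₃ : ¬ (i = j ∧ k = l)) : X (i, j) (k, l) = 0 := by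
  have hi := apply_eq_sign_mul_apply hX i i j k l
  have hj := apply_eq_sign_mul_apply hX j i j k l
  have hk := apply_eq_sign_mul_apply hX k i j k l
  have key : ∀ z : ℂ, z = -z → z = 0 := fun z hz => by linear_combination hz / 2
  apply key
  grind

/-- Rotating in a coordinate plane expresses the diagonal entries by the pairings. -/
lemma apply_self {X : Matrix (Fin d × Fin d) (Fin d × Fin d) ℂ}
    (hX : ∀ Q, conjKron X Q = X) {p q : Fin d} (hpq : p ≠ q) :
    X (p, p) (p, p) = X (p, q) (p, q) + X (p, q) (q, p) + X (p, p) (q, q) := by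
  obtain ⟨Q, hQ⟩ := exists_orthC_row hpq
  obtain ⟨σ, hp, hq⟩ := exists_perm_map_pair hpq hpq.symm
  have h := conjKron_apply X Q p p p p
  rw [hX] at h
  simp only [hQ, add_mul, ite_mul, zero_mul, Finset.sum_add_distrib, Finset.sum_ite_eq',
    Finset.mem_univ, if_true] at h
  have hz : ∀ {i j k l : Fin d}, ¬ (i = k ∧ j = l) → ¬ (i = l ∧ j = k) → ¬ (i = j ∧ k = l) →
    X (i, j) (k, l) = 0 := apply_eq_zero hX
  have e1 := apply_perm hX σ p p p p
  have e2 := apply_perm hX σ p q p q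
  have e3 := apply_perm hX σ p q q p
  have e4 := apply_perm hX σ p p q q
  rw [hz (i := p) (j := p) (k := p) (l := q) (by simp [hpq]) (by simp [hpq]) (by simp [hpq]),
    hz (i := p) (j := p) (k := q) (l := p) (by simp [hpq]) (by simp [hpq]) (by simp [hpq.symm]),
    hz (i := p) (j := q) (k := p) (l := p) (by simp [hpq.symm]) (by simp [hpq.symm])
      (by simp [hpq]),
    hz (i := q) (j := p) (k := p) (l := p) (by simp [hpq.symm]) (by simp [hpq.symm])
      (by simp [hpq.symm]),
    hz (i := q) (j := q) (k := q) (l := p) (by simp [hpq.symm]) (by simp [hpq.symm])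
      (by simp [hpq.symm]),
    hz (i := q) (j := q) (k := p) (l := q) (by simp [hpq.symm]) (by simp [hpq.symm])
      (by simp [hpq]),
    hz (i := q) (j := p) (k := q) (l := q) (by simp [hpq]) (by simp [hpq]) (by simp [hpq.symm]),
    hz (i := p) (j := q) (k := q) (l := q) (by simp [hpq]) (by simp [hpq]) (by simp [hpq])] at h
  simp only [hp, hq] at e1 e2 e3 e4
  rw [← e1, ← e2, ← e3, ← e4] at h
  linear_combination (625 / 288 : ℂ) * h

/-- The commutant of `O ⊗ O` is spanned by `1`, the swap, and its partial transpose. -/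
lemma eq_smul_add_of_invariant {X : Matrix (Fin d × Fin d) (Fin d × Fin d) ℂ}
    (hX : ∀ Q, conjKron X Q = X) {r s : Fin d} (hrs : r ≠ s) :
    X = X (r, s) (r, s) • (1 : Matrix (Fin d × Fin d) (Fin d × Fin d) ℂ) +
      X (r, s) (s, r) • swapOp d + X (r, r) (s, s) • ptB (swapOp d) := by
  have hp {p q : Fin d} (hpq : p ≠ q) : X (p, q) (p, q) = X (r, s) (r, s) ∧
      X (p, q) (q, p) = X (r, s) (s, r) ∧ X (p, p) (q, q) = X (r, r) (s, s) := by
    obtain ⟨σ, rfl, rfl⟩ := exists_perm_map_pair hpq hrs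
    exact ⟨apply_perm hX σ _ _ _ _, apply_perm hX σ _ _ _ _, apply_perm hX σ _ _ _ _⟩
  ext ⟨i, j⟩ ⟨k, l⟩
  simp only [Matrix.add_apply, Matrix.smul_apply, ptB_swapOp_apply, Matrix.one_apply,
    swapOp_apply, Prod.mk.injEq, smul_eq_mul, mul_ite, mul_one, mul_zero]
  by_cases h₁ : i = k ∧ j = l
  · obtain ⟨rfl, rfl⟩ := h₁
    by_cases hij : i = j
    · subst hij
      have hq : ∃ q, i ≠ q := by
        by_cases h : i = r
        · exact ⟨s, h ▸ hrs⟩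
        · exact ⟨r, h⟩
      obtain ⟨q, hq⟩ := hq
      simp [apply_self hX hq, hp hq]
    · simp [hij, hp hij]
  · by_cases h₂ : i = l ∧ j = k
    · obtain ⟨rfl, rfl⟩ := h₂
      have hij : i ≠ j := fun h => h₁ ⟨h, h.symm⟩
      simp [hij, hp hij]
    · by_cases h₃ : i = j ∧ k = l
      · obtain ⟨rfl, rfl⟩ := h₃
        have hik : i ≠ k := fun h => h₁ ⟨h, h⟩
        simp [hik, hp hik]
      · simp [h₁, h₂, h₃, apply_eq_zero hX h₁ h₂ h₃]

lemma swapOp_mul_swapOp : swapOp d * swapOp d = 1 := by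
  ext p q
  rw [swapOp_mul_apply]
  simp [swapOp, Matrix.one_apply, Prod.ext_iff, and_comm]

lemma swapOp_mul_ptB_swapOp : swapOp d * ptB (swapOp d) = ptB (swapOp d) := by
  ext p q
  rw [swapOp_mul_apply, ptB_swapOp_apply, ptB_swapOp_apply]
  simp [eq_comm]

lemma ptB_swapOp_mul_swapOp : ptB (swapOp d) * swapOp d = ptB (swapOp d) := by
  ext p q
  rw [mul_swapOp_apply, ptB_swapOp_apply, ptB_swapOp_apply]
  simp [eq_comm]

lemma ptB_swapOp_mul_self : ptB (swapOp d) * ptB (swapOp d) = (d : ℂ) • ptB (swapOp d) := by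
  rw [ptB_swapOp_eq_vecMulVec, Matrix.vecMulVec_mul_vecMulVec, Matrix.vecMulVec_smul]
  simp [dotProduct, Fintype.sum_prod_type]

lemma trace_swapOp : Matrix.trace (swapOp d) = d := by
  simp only [Matrix.trace, Matrix.diag_apply, swapOp_apply, Fintype.sum_prod_type]
  simp [eq_comm]

lemma trace_ptB_swapOp : Matrix.trace (ptB (swapOp d)) = d := by
  simp only [Matrix.trace, Matrix.diag_apply, ptB_swapOp_apply, Fintype.sum_prod_type]
  simp

end Twirl

/-- Schur–Weyl twirl over the orthogonal group:
`∫ (O ⊗ₖ O) * A * (O ⊗ₖ O)ᵀ dμ_O(O) = c₁ • 1 + c₂ • S + c₃ • S^{T_B}`, with the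
coefficients `c₁, c₂, c₃` as in the paper, where real orthogonal matrices are regarded as
complex matrices entrywise. -/
theorem orthogonal_twirl (d : ℕ) (hd : 2 ≤ d)
    (A : Matrix (Fin d × Fin d) (Fin d × Fin d) ℂ)
    (μO : Measure (Matrix.orthogonalGroup (Fin d) ℝ)) [μO.IsHaarMeasure]
    [IsProbabilityMeasure μO] :
    (∫ O : Matrix.orthogonalGroup (Fin d) ℝ,
        (((O : Matrix (Fin d) (Fin d) ℝ).map Complex.ofReal) ⊗ₖ
            ((O : Matrix (Fin d) (Fin d) ℝ).map Complex.ofReal)) * A *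
          (((O : Matrix (Fin d) (Fin d) ℝ).map Complex.ofReal) ⊗ₖ
            ((O : Matrix (Fin d) (Fin d) ℝ).map Complex.ofReal))ᵀ ∂μO) =
      ((((d : ℂ) + 1) * Matrix.trace A - Matrix.trace (swapOp d * A)
          - Matrix.trace (ptB (swapOp d) * A)) / ((d : ℂ) * (d - 1) * (d + 2))) •
        (1 : Matrix (Fin d × Fin d) (Fin d × Fin d) ℂ) +
      ((-Matrix.trace A + ((d : ℂ) + 1) * Matrix.trace (swapOp d * A)
          - Matrix.trace (ptB (swapOp d) * A)) / ((d : ℂ) * (d - 1) * (d + 2))) •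
        swapOp d +
      ((-Matrix.trace A - Matrix.trace (swapOp d * A)
          + ((d : ℂ) + 1) * Matrix.trace (ptB (swapOp d) * A)) / ((d : ℂ) * (d - 1) * (d + 2))) •
        ptB (swapOp d) := by
  change (∫ O, conjKron A O ∂μO) = _
  have hX := eq_smul_add_of_invariant (conjKron_integral A μO)
    (r := ⟨0, by omega⟩) (s := ⟨1, by omega⟩) (by simp)
  have t₁ := trace_mul_integral_conjKron A 1 μO (by simp [kronecker_transpose_mul_self])
  have t₂ := trace_mul_integral_conjKron A _ μO swapOp_conj_kronecker
  have t₃ := trace_mul_integral_conjKron A _ μO ptB_swapOp_conj_kronecker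
  generalize (∫ O, conjKron A O ∂μO) = X at *
  generalize X (_, _) (_, _) = β at hX
  generalize X (⟨0, _⟩, _) (_, ⟨0, _⟩) = γ at hX
  generalize X (_, _) (_, _) = α at hX
  subst hX
  simp only [Matrix.mul_add, Matrix.mul_smul, Matrix.one_mul, Matrix.mul_one, swapOp_mul_swapOp,
    swapOp_mul_ptB_swapOp, ptB_swapOp_mul_swapOp, ptB_swapOp_mul_self, Matrix.trace_add,
    Matrix.trace_smul, trace_swapOp, trace_ptB_swapOp, Matrix.trace_one, Fintype.card_prod,
    Fintype.card_fin, Nat.cast_mul, smul_eq_mul] at t₁ t₂ t₃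
  have hd0 : (d : ℂ) ≠ 0 := by
    exact_mod_cast (by omega : d ≠ 0)
  have hd1 : (d : ℂ) - 1 ≠ 0 := by
    rw [sub_ne_zero]
    exact_mod_cast (by omega : d ≠ 1)
  have hd2 : (d : ℂ) + 2 ≠ 0 := by
    exact_mod_cast (by omega : d + 2 ≠ 0)
  rw [← t₁, ← t₂, ← t₃]
  congr 3 <;> field_simp <;> ring
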